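/- Fix m, k ∈ ℕ and for each N ≥ m+k let Z_N be the m×k upper-left block of a Haar-distributed matrix in O(N). Let β_N be a sequence of positive reals with β_N → ∞ and β_N = o(√N). Then for every A ∈ ℝ^{m×k}, lim_{r→0} liminf_{N→∞} (β_N²/N)·log ℙ(β_N·Z_N ∈ B_r(A)) ≥ −(1/2)·‖A‖_F², where B_r(A) is the open Euclidean (Frobenius-norm) ball of radius r around A in ℝ^{m×k}. -/

import Mathlib

open MeasureTheory Filter Matrix Asymptotics

noncomputable instance matrixMeasurableSpace {N : ℕ} :
    MeasurableSpace (Matrix (Fin N) (Fin N) ℝ) :=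
  show MeasurableSpace (Fin N → Fin N → ℝ) from inferInstance

/-- Squared Frobenius norm of a matrix. -/
def frobSq {m k : ℕ} (B : Matrix (Fin m) (Fin k) ℝ) : ℝ :=
  ∑ i, ∑ j, (B i j) ^ 2

/-- Frobenius norm of a matrix. -/
noncomputable def frobNorm {m k : ℕ} (B : Matrix (Fin m) (Fin k) ℝ) : ℝ :=
  Real.sqrt (frobSq B)

/-- The upper-left `m × k` block of an `N × N` matrix (padded with zeros if needed). -/
def blockEmb (m k : ℕ) {N : ℕ} (A : Matrix (Fin N) (Fin N) ℝ) :
    Matrix (Fin m) (Fin k) ℝ :=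
  Matrix.of fun i j => if h : (i : ℕ) < N ∧ (j : ℕ) < N then A ⟨i, h.1⟩ ⟨j, h.2⟩ else 0

section Frobenius

attribute [local instance] Matrix.frobeniusNormedAddCommGroup Matrix.frobeniusNormedRing
  Matrix.frobeniusNormedSpace

theorem frobSq_eq_trace {m k : ℕ} (B : Matrix (Fin m) (Fin k) ℝ) :
    frobSq B = (B * Bᵀ).trace := by
  simp [frobSq, Matrix.trace, Matrix.mul_apply, pow_two]

theorem frobNorm_eq_norm {m k : ℕ} (B : Matrix (Fin m) (Fin k) ℝ) : frobNorm B = ‖B‖ := by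
  rw [frobNorm, frobSq, Matrix.frobenius_norm_def, Real.sqrt_eq_rpow]
  simp

theorem frobNorm_mul_le {l m k : ℕ} (B : Matrix (Fin l) (Fin m) ℝ) (C : Matrix (Fin m) (Fin k) ℝ) :
    frobNorm (B * C) ≤ frobNorm B * frobNorm C := by
  simpa only [frobNorm_eq_norm] using Matrix.frobenius_norm_mul B C

theorem frobNorm_add_le {m k : ℕ} (B C : Matrix (Fin m) (Fin k) ℝ) :
    frobNorm (B + C) ≤ frobNorm B + frobNorm C := by
  simpa only [frobNorm_eq_norm] using norm_add_le B C

end Frobenius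

theorem frobNorm_nonneg {m k : ℕ} (B : Matrix (Fin m) (Fin k) ℝ) : 0 ≤ frobNorm B :=
  Real.sqrt_nonneg _

theorem abs_inv_sqrt_sub_one_le {d : ℝ} (hd : 1 / 2 ≤ d) : |(√d)⁻¹ - 1| ≤ |d - 1| := by
  have hs : 0 < √d := Real.sqrt_pos.2 (by linarith)
  have hsq : √d ^ 2 = d := Real.sq_sqrt (by linarith)
  have h2 : 1 / 2 ≤ √d := by nlinarith
  have h3 : 1 ≤ √d * (√d + 1) := by nlinarith
  have : d - 1 = (1 - (√d)⁻¹) * (√d * (√d + 1)) := by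
    field_simp
    nlinarith
  rw [this, abs_mul, abs_sub_comm, abs_of_pos (show 0 < √d * (√d + 1) by positivity)]
  exact le_mul_of_one_le_right (abs_nonneg _) h3

theorem frobSq_conj_diagonal {m : ℕ} (U : Matrix (Fin m) (Fin m) ℝ) (hU : Uᵀ * U = 1)
    (d : Fin m → ℝ) : frobSq (U * diagonal d * Uᵀ) = ∑ i, d i ^ 2 := by
  have : U * diagonal d * Uᵀ * (U * diagonal d * Uᵀ)ᵀ = U * (diagonal fun i => d i ^ 2) * Uᵀ := by
    simp only [Matrix.transpose_mul, Matrix.transpose_transpose, Matrix.diagonal_transpose]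
    calc _ = U * diagonal d * (Uᵀ * U) * diagonal d * Uᵀ := by simp only [Matrix.mul_assoc]
      _ = _ := by
        rw [hU, Matrix.mul_one, Matrix.mul_assoc U, Matrix.diagonal_mul_diagonal]
        simp only [pow_two]
  rw [frobSq_eq_trace, this, Matrix.mul_assoc, Matrix.trace_mul_comm, Matrix.mul_assoc, hU,
    Matrix.mul_one, Matrix.trace_diagonal]

/-- A symmetric matrix close to the identity has an inverse square root at most as far from it. -/
theorem exists_mul_mul_transpose_eq_one {m : ℕ} (S : Matrix (Fin m) (Fin m) ℝ) (hS : Sᵀ = S)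
    (h : frobNorm (S - 1) ≤ 1 / 2) :
    ∃ T : Matrix (Fin m) (Fin m) ℝ, T * S * Tᵀ = 1 ∧ frobNorm (T - 1) ≤ frobNorm (S - 1) := by
  have hH : S.IsHermitian := by
    rw [Matrix.IsHermitian, Matrix.conjTranspose_eq_transpose_of_trivial, hS]
  set U : Matrix (Fin m) (Fin m) ℝ := (hH.eigenvectorUnitary : Matrix (Fin m) (Fin m) ℝ) with hUdef
  set d := hH.eigenvalues with hd
  have hUU : Uᵀ * U = 1 := by
    have := Unitary.coe_star_mul_self hH.eigenvectorUnitary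
    rwa [Matrix.star_eq_conjTranspose, Matrix.conjTranspose_eq_transpose_of_trivial] at this
  have hUU' : U * Uᵀ = 1 := mul_eq_one_comm.1 hUU
  have hSd : S = U * diagonal d * Uᵀ := by
    have := hH.spectral_theorem
    rw [Unitary.conjStarAlgAut_apply, Matrix.star_eq_conjTranspose,
      Matrix.conjTranspose_eq_transpose_of_trivial] at this
    exact this
  have hsub : ∀ e : Fin m → ℝ, U * diagonal e * Uᵀ - 1 = U * diagonal (fun i => e i - 1) * Uᵀ := by
    intro e
    rw [← Matrix.diagonal_sub, Matrix.mul_sub, Matrix.sub_mul, Matrix.diagonal_one, Matrix.mul_one,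
      hUU']
  have hfS : frobSq (S - 1) = ∑ i, (d i - 1) ^ 2 := by
    rw [hSd, hsub, frobSq_conj_diagonal U hUU]
  have hd2 : ∀ i, 1 / 2 ≤ d i := by
    intro i
    have h1 : (d i - 1) ^ 2 ≤ (1 / 2) ^ 2 := by
      refine (Finset.single_le_sum (f := fun i => (d i - 1) ^ 2) (fun _ _ => sq_nonneg _)
        (Finset.mem_univ i)).trans ?_
      rw [← hfS]
      exact (Real.sqrt_le_left (by norm_num)).1 h
    have := abs_le_of_sq_le_sq' h1 (by norm_num)
    linarith [this.1]
  refine ⟨U * diagonal (fun i => (√(d i))⁻¹) * Uᵀ, ?_, ?_⟩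
  · rw [hSd]
    simp only [Matrix.transpose_mul, Matrix.transpose_transpose, Matrix.diagonal_transpose]
    calc _ = U * diagonal (fun i => (√(d i))⁻¹) * (Uᵀ * U) * diagonal d * (Uᵀ * U) *
          diagonal (fun i => (√(d i))⁻¹) * Uᵀ := by simp only [Matrix.mul_assoc]
      _ = U * (diagonal (fun i => (√(d i))⁻¹) * diagonal d * diagonal (fun i => (√(d i))⁻¹)) *
          Uᵀ := by rw [hUU]; simp only [Matrix.mul_assoc, Matrix.one_mul]
      _ = 1 := by
        rw [Matrix.diagonal_mul_diagonal, Matrix.diagonal_mul_diagonal]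
        have : (fun i => (√(d i))⁻¹ * d i * (√(d i))⁻¹) = fun _ => 1 := by
          funext i
          have h0 : 0 < d i := by linarith [hd2 i]
          have hs : 0 < √(d i) := Real.sqrt_pos.2 h0
          field_simp
          rw [Real.sq_sqrt h0.le]
        rw [this, Matrix.diagonal_one, Matrix.mul_one, hUU']
  · rw [hsub]
    refine Real.sqrt_le_sqrt ?_
    rw [hfS, frobSq_conj_diagonal U hUU]
    exact Finset.sum_le_sum fun i _ => sq_le_sq.2 (abs_inv_sqrt_sub_one_le (hd2 i))

/-- A matrix with orthonormal rows is the upper part of an orthogonal matrix. -/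
theorem exists_orthogonal_extension {m N : ℕ} (hmN : m ≤ N) (F : Matrix (Fin m) (Fin N) ℝ)
    (hF : F * Fᵀ = 1) :
    ∃ O : Matrix (Fin N) (Fin N) ℝ, O * Oᵀ = 1 ∧ ∀ i j, O (Fin.castLE hmN i) j = F i j := by
  let v : Fin N → EuclideanSpace ℝ (Fin N) := fun i =>
    WithLp.toLp 2 (fun j => if h : (i : ℕ) < m then F ⟨i, h⟩ j else 0)
  let s : Set (Fin N) := {i | (i : ℕ) < m}
  have hv : Orthonormal ℝ (s.domRestrict v) := by
    rw [orthonormal_iff_ite]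
    rintro ⟨i, hi⟩ ⟨j, hj⟩
    have hi' : (i : ℕ) < m := hi
    have hj' : (j : ℕ) < m := hj
    have := congrFun (congrFun hF ⟨j, hj'⟩) ⟨i, hi'⟩
    simp only [Matrix.mul_apply, Matrix.transpose_apply, Matrix.one_apply, Fin.mk.injEq] at this
    have hvi : s.domRestrict v ⟨i, hi⟩ = WithLp.toLp 2 (F ⟨i, hi'⟩) := by
      simp only [Set.domRestrict_apply, v, hi', dite_true]
    have hvj : s.domRestrict v ⟨j, hj⟩ = WithLp.toLp 2 (F ⟨j, hj'⟩) := by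
      simp only [Set.domRestrict_apply, v, hj', dite_true]
    rw [hvi, hvj]
    simp only [PiLp.inner_apply, RCLike.inner_apply, conj_trivial, this, Subtype.mk.injEq,
      Fin.ext_iff, eq_comm]
  obtain ⟨b, hb⟩ := hv.exists_orthonormalBasis_extension_of_card_eq (by simp)
  refine ⟨Matrix.of fun i j => b i j, ?_, ?_⟩
  · ext i j
    have := orthonormal_iff_ite.1 b.orthonormal j i
    simp only [PiLp.inner_apply, RCLike.inner_apply, conj_trivial] at this
    simp only [Matrix.mul_apply, Matrix.transpose_apply, Matrix.of_apply, Matrix.one_apply, this,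
      eq_comm]
  · intro i j
    have hi : Fin.castLE hmN i ∈ s := i.2
    simp only [Matrix.of_apply, hb _ hi, v]
    simp

/-- The law of an `N × m` matrix with independent standard Gaussian entries. -/
noncomputable def gaussianMatrix (N m : ℕ) : Measure (Fin N → Fin m → ℝ) :=
  Measure.pi fun _ => Measure.pi fun _ => ProbabilityTheory.gaussianReal 0 1

instance (N m : ℕ) : IsProbabilityMeasure (gaussianMatrix N m) := by
  unfold gaussianMatrix; infer_instance

theorem map_curry_pi_gaussianReal (N m : ℕ) :
    (Measure.pi fun _ : Fin N × Fin m => ProbabilityTheory.gaussianReal 0 1).map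
      (MeasurableEquiv.curry (Fin N) (Fin m) ℝ) = gaussianMatrix N m := by
  have := Measure.infinitePi_map_curry
    (fun (_ : Fin N) (_ : Fin m) => ProbabilityTheory.gaussianReal 0 1)
  simpa only [Measure.infinitePi_eq_pi, gaussianMatrix] using this

theorem map_toLp_isometry_pi_gaussianReal {ι : Type*} [Fintype ι]
    (R : EuclideanSpace ℝ ι →ₗᵢ[ℝ] EuclideanSpace ℝ ι) :
    (Measure.pi fun _ : ι => ProbabilityTheory.gaussianReal 0 1).map
      (fun x => (R (WithLp.toLp 2 x)).ofLp) =
      Measure.pi fun _ : ι => ProbabilityTheory.gaussianReal 0 1 := by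
  have h1 := ProbabilityTheory.map_pi_eq_stdGaussian (ι := ι)
  have h2 := ProbabilityTheory.stdGaussian_map (R.toLinearIsometryEquiv rfl)
  have hR : Measurable R := R.continuous.measurable
  have h3 : (fun x : ι → ℝ => (R (WithLp.toLp 2 x)).ofLp) =
      (WithLp.ofLp ∘ (R.toLinearIsometryEquiv rfl)) ∘ WithLp.toLp 2 := rfl
  have hR' : Measurable (R.toLinearIsometryEquiv rfl) := hR
  have ho : Measurable (WithLp.ofLp : EuclideanSpace ℝ ι → ι → ℝ) := by fun_prop
  have ht : Measurable (WithLp.toLp 2 : (ι → ℝ) → EuclideanSpace ℝ ι) := by fun_prop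
  rw [h3, ← Measure.map_map (ho.comp hR') ht, h1, ← Measure.map_map ho hR', h2, ← h1,
    Measure.map_map ho ht]
  exact Measure.map_id

/-- Left multiplication by an orthogonal matrix preserves the Gaussian law. -/
theorem map_mul_gaussianMatrix {N m : ℕ} (B : Matrix (Fin N) (Fin N) ℝ) (hB : Bᵀ * B = 1) :
    (gaussianMatrix N m).map (fun H i a => ∑ j, B i j * H j a) = gaussianMatrix N m := by
  let L : EuclideanSpace ℝ (Fin N × Fin m) →ₗ[ℝ] EuclideanSpace ℝ (Fin N × Fin m) :=
    { toFun := fun x => WithLp.toLp 2 fun p => ∑ j, B p.1 j * x (j, p.2)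
      map_add' := by
        intro x y
        ext p
        simp [mul_add, Finset.sum_add_distrib]
      map_smul' := by
        intro c x
        ext p
        simp [Finset.mul_sum, mul_left_comm] }
  have hL : ∀ x, ‖L x‖ = ‖x‖ := by
    intro x
    refine (sq_eq_sq₀ (norm_nonneg _) (norm_nonneg _)).1 ?_
    rw [EuclideanSpace.real_norm_sq_eq, EuclideanSpace.real_norm_sq_eq, Fintype.sum_prod_type_right,
      Fintype.sum_prod_type_right]
    refine Finset.sum_congr rfl fun a _ => ?_
    have : (B *ᵥ fun j => x (j, a)) ⬝ᵥ (B *ᵥ fun j => x (j, a)) =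
        (fun j => x (j, a)) ⬝ᵥ fun j => x (j, a) := by
      rw [Matrix.dotProduct_mulVec, Matrix.vecMul_mulVec, hB, Matrix.vecMul_one]
    simpa [dotProduct, Matrix.mulVec, pow_two, L] using this
  let R : EuclideanSpace ℝ (Fin N × Fin m) →ₗᵢ[ℝ] EuclideanSpace ℝ (Fin N × Fin m) := ⟨L, hL⟩
  have hT : Measurable fun (H : Fin N → Fin m → ℝ) (i : Fin N) (a : Fin m) =>
      ∑ j, B i j * H j a := by fun_prop
  have hR : Measurable fun x : Fin N × Fin m → ℝ => (R (WithLp.toLp 2 x)).ofLp := by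
    have := R.continuous.measurable
    fun_prop
  rw [← map_curry_pi_gaussianReal, Measure.map_map hT (MeasurableEquiv.measurable _)]
  conv_rhs => rw [← map_toLp_isometry_pi_gaussianReal R]
  rw [Measure.map_map (MeasurableEquiv.measurable _) hR]
  rfl

/-- The Gram matrix of the columns of `H`. -/
def gramMatrix {N m : ℕ} (H : Fin N → Fin m → ℝ) : Matrix (Fin m) (Fin m) ℝ :=
  (Matrix.of H)ᵀ * Matrix.of H

/-- The transpose of the first `k` rows of `H`. -/
def topRows {N m k : ℕ} (hk : k ≤ N) (H : Fin N → Fin m → ℝ) : Matrix (Fin m) (Fin k) ℝ :=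
  Matrix.of fun a j => H (Fin.castLE hk j) a

/-- Matrices whose normalized Gram matrix is close to the identity and whose rescaled top rows
are close to `A`. -/
def goodSet {N m k : ℕ} (hk : k ≤ N) (A : Matrix (Fin m) (Fin k) ℝ) (c η δ : ℝ) :
    Set (Fin N → Fin m → ℝ) :=
  {H | frobNorm ((N : ℝ)⁻¹ • gramMatrix H - 1) < η ∧ frobNorm (c • topRows hk H - A) < δ}

theorem measurableSet_goodSet {N m k : ℕ} (hk : k ≤ N) (A : Matrix (Fin m) (Fin k) ℝ)
    (c η δ : ℝ) : MeasurableSet (goodSet hk A c η δ) := by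
  have h1 : Measurable fun H : Fin N → Fin m → ℝ =>
      frobNorm ((N : ℝ)⁻¹ • gramMatrix H - 1) := by
    simp only [frobNorm, frobSq, gramMatrix, Matrix.sub_apply, Matrix.smul_apply, Matrix.mul_apply,
      Matrix.transpose_apply, Matrix.of_apply, smul_eq_mul]
    fun_prop
  have h2 : Measurable fun H : Fin N → Fin m → ℝ => frobNorm (c • topRows hk H - A) := by
    simp only [frobNorm, frobSq, topRows, Matrix.sub_apply, Matrix.smul_apply,
      Matrix.of_apply, smul_eq_mul]
    fun_prop
  exact (measurableSet_lt h1 measurable_const).inter (measurableSet_lt h2 measurable_const)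

theorem gramMatrix_transpose_mul {N m : ℕ} (M : Matrix (Fin N) (Fin N) ℝ) (hM : M * Mᵀ = 1)
    (H : Fin N → Fin m → ℝ) : gramMatrix (fun i a => ∑ j, M j i * H j a) = gramMatrix H := by
  have : Matrix.of (fun i a => ∑ j, M j i * H j a) = Mᵀ * Matrix.of H := by
    ext i a
    simp [Matrix.mul_apply]
  rw [gramMatrix, this, Matrix.transpose_mul, Matrix.transpose_transpose, Matrix.mul_assoc,
    ← Matrix.mul_assoc M, hM, Matrix.one_mul, gramMatrix]

theorem measurable_matrix_mul_left {N : ℕ} (B : Matrix (Fin N) (Fin N) ℝ) :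
    Measurable fun M : Matrix (Fin N) (Fin N) ℝ => B * M := by
  refine measurable_pi_lambda _ fun i => measurable_pi_lambda _ fun j => ?_
  simp only [Matrix.mul_apply]
  exact Finset.measurable_sum _ fun l _ => ((measurable_pi_apply j).comp
    (measurable_pi_apply (X := fun _ : Fin N => Fin N → ℝ) l)).const_mul _

theorem measurableSet_orthogonal (N : ℕ) :
    MeasurableSet {M : Matrix (Fin N) (Fin N) ℝ | M * Mᵀ = 1} := by
  have h : ∀ i l, Measurable fun M : Matrix (Fin N) (Fin N) ℝ => M i l := fun i l =>
    (measurable_pi_apply l).comp (measurable_pi_apply (X := fun _ : Fin N => Fin N → ℝ) i)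
  simp only [← Matrix.ext_iff, Set.ofPred_forall, Matrix.mul_apply, Matrix.transpose_apply]
  exact MeasurableSet.iInter fun i => MeasurableSet.iInter fun j => measurableSet_eq_fun
    (Finset.measurable_sum _ fun l _ => (h i l).mul (h j l)) measurable_const

/-- For a fixed matrix `H`, rotations sending `H` to a good matrix are at most as likely as
rotations whose block is close to `A`. -/
theorem measure_rotate_mem_goodSet_le {N m k : ℕ} (hm : m ≤ N) (hk : k ≤ N)
    (μ : Measure (Matrix (Fin N) (Fin N) ℝ)) (hμ : ∀ᵐ M ∂μ, M * Mᵀ = 1)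
    (hμ_inv : ∀ B : Matrix (Fin N) (Fin N) ℝ, B * Bᵀ = 1 → μ.map (fun M => B * M) = μ)
    (A : Matrix (Fin m) (Fin k) ℝ) {b η δ r : ℝ} (hη : η ≤ 1 / 2)
    (hr : η * δ + δ + η * frobNorm A ≤ r) (H : Fin N → Fin m → ℝ) :
    μ {M | (fun i a => ∑ j, M j i * H j a) ∈ goodSet hk A (b / √N) η δ} ≤
      μ {M | frobNorm (b • blockEmb m k M - A) < r} := by
  by_cases hex : frobNorm ((N : ℝ)⁻¹ • gramMatrix H - 1) < η
  swap
  · refine (measure_mono_null_ae ?_ (measure_empty (μ := μ))).le.trans zero_le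
    filter_upwards [hμ] with M hM hMG
    have := hMG.1
    rw [gramMatrix_transpose_mul M hM] at this
    exact hex this
  have hsym : ((N : ℝ)⁻¹ • gramMatrix H)ᵀ = (N : ℝ)⁻¹ • gramMatrix H := by
    simp [gramMatrix, Matrix.transpose_mul]
  obtain ⟨T, hT, hT1⟩ := exists_mul_mul_transpose_eq_one _ hsym (hex.le.trans hη)
  have hT2 : frobNorm (T - 1) < η := hT1.trans_lt hex
  have hNs : (√(N : ℝ))⁻¹ * (√(N : ℝ))⁻¹ = (N : ℝ)⁻¹ := by
    rw [← mul_inv, Real.mul_self_sqrt (Nat.cast_nonneg _)]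
  obtain ⟨O, hO, hOF⟩ := exists_orthogonal_extension hm ((√(N : ℝ))⁻¹ • (T * (Matrix.of H)ᵀ)) (by
    rw [← hT, Matrix.transpose_smul, Matrix.transpose_mul, Matrix.transpose_transpose,
      Matrix.smul_mul, Matrix.mul_smul, smul_smul, hNs, gramMatrix, Matrix.mul_smul,
      Matrix.smul_mul]
    simp only [Matrix.mul_assoc])
  calc μ {M | (fun i a => ∑ j, M j i * H j a) ∈ goodSet hk A (b / √N) η δ}
      ≤ μ ((fun M => O * M) ⁻¹' {M | frobNorm (b • blockEmb m k M - A) < r}) := by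
        refine measure_mono fun M hM => ?_
        have hY := hM.2
        set Y := (b / √N) • topRows hk (fun i a => ∑ j, M j i * H j a) with hYdef
        have key : b • blockEmb m k (O * M) = T * Y := by
          ext i j
          have hij : (i : ℕ) < N ∧ (j : ℕ) < N := ⟨by omega, by omega⟩
          have hi : (⟨(i : ℕ), hij.1⟩ : Fin N) = Fin.castLE hm i := rfl
          have hj : (⟨(j : ℕ), hij.2⟩ : Fin N) = Fin.castLE hk j := rfl
          simp only [hYdef, Matrix.smul_apply, blockEmb, Matrix.of_apply, hij, and_self, dite_true,
            Matrix.mul_apply, hi, hj, hOF, topRows, smul_eq_mul, Matrix.transpose_apply,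
            Finset.mul_sum, Finset.sum_mul]
          rw [Finset.sum_comm]
          refine Finset.sum_congr rfl fun a _ => Finset.sum_congr rfl fun l _ => ?_
          ring
        have hdec : b • blockEmb m k (O * M) - A = (T - 1) * (Y - A) + ((Y - A) + (T - 1) * A) := by
          rw [key, Matrix.mul_sub, Matrix.sub_mul, Matrix.sub_mul, Matrix.one_mul, Matrix.one_mul]
          abel
        change frobNorm (b • blockEmb m k (O * M) - A) < r
        rw [hdec]
        have e1 := frobNorm_add_le ((T - 1) * (Y - A)) ((Y - A) + (T - 1) * A)
        have e2 := frobNorm_add_le (Y - A) ((T - 1) * A)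
        have e3 := frobNorm_mul_le (T - 1) (Y - A)
        have e4 := frobNorm_mul_le (T - 1) A
        have n1 := frobNorm_nonneg (T - 1)
        have n2 := frobNorm_nonneg A
        have n3 := frobNorm_nonneg (Y - A)
        have e5 : frobNorm (T - 1) * frobNorm (Y - A) ≤ η * δ :=
          mul_le_mul hT2.le hY.le n3 (n1.trans hT2.le)
        have e6 : frobNorm (T - 1) * frobNorm A ≤ η * frobNorm A :=
          mul_le_mul_of_nonneg_right hT2.le n2
        linarith
    _ ≤ (μ.map fun M => O * M) {M | frobNorm (b • blockEmb m k M - A) < r} :=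
        Measure.le_map_apply (measurable_matrix_mul_left O).aemeasurable _
    _ = _ := by rw [hμ_inv O hO]

theorem gaussianMatrix_goodSet_le {N m k : ℕ} (hm : m ≤ N) (hk : k ≤ N)
    (μ : Measure (Matrix (Fin N) (Fin N) ℝ)) [IsProbabilityMeasure μ] (hμ : ∀ᵐ M ∂μ, M * Mᵀ = 1)
    (hμ_inv : ∀ B : Matrix (Fin N) (Fin N) ℝ, B * Bᵀ = 1 → μ.map (fun M => B * M) = μ)
    (A : Matrix (Fin m) (Fin k) ℝ) {b η δ r : ℝ} (hη : η ≤ 1 / 2)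
    (hr : η * δ + δ + η * frobNorm A ≤ r) :
    gaussianMatrix N m (goodSet hk A (b / √N) η δ) ≤
      μ {M | frobNorm (b • blockEmb m k M - A) < r} := by
  set G := goodSet hk A (b / √N) η δ with hG
  have hGm : MeasurableSet G := measurableSet_goodSet _ _ _ _ _
  let act : Matrix (Fin N) (Fin N) ℝ × (Fin N → Fin m → ℝ) → Fin N → Fin m → ℝ :=
    fun p i a => ∑ j, p.1 j i * p.2 j a
  have hact : Measurable act := by
    refine measurable_pi_lambda _ fun i => measurable_pi_lambda _ fun a => ?_
    refine Finset.measurable_sum _ fun j _ => Measurable.mul ?_ (by fun_prop)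
    exact ((measurable_pi_apply i).comp
      (measurable_pi_apply (X := fun _ : Fin N => Fin N → ℝ) j)).comp measurable_fst
  have h1 : (μ.prod (gaussianMatrix N m)) (act ⁻¹' G) = gaussianMatrix N m G := by
    rw [Measure.prod_apply (hact hGm)]
    have : ∀ᵐ M ∂μ, gaussianMatrix N m (Prod.mk M ⁻¹' (act ⁻¹' G)) = gaussianMatrix N m G := by
      filter_upwards [hμ] with M hM
      have hB : (Mᵀ)ᵀ * Mᵀ = 1 := by rw [Matrix.transpose_transpose, hM]
      conv_rhs => rw [← map_mul_gaussianMatrix Mᵀ hB]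
      rw [Measure.map_apply (by fun_prop) hGm]
      rfl
    rw [lintegral_congr_ae this]
    simp
  rw [← h1, Measure.prod_apply_symm (hact hGm)]
  calc _ ≤ ∫⁻ _, μ {M | frobNorm (b • blockEmb m k M - A) < r} ∂(gaussianMatrix N m) :=
        lintegral_mono fun H => measure_rotate_mem_goodSet_le hm hk μ hμ hμ_inv A hη hr H
    _ = _ := by simp

/-- The standard Gaussian law on `ℝ^m`. -/
noncomputable def gaussianVector (m : ℕ) : Measure (Fin m → ℝ) :=
  Measure.pi fun _ => ProbabilityTheory.gaussianReal 0 1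

instance (m : ℕ) : IsProbabilityMeasure (gaussianVector m) := by
  unfold gaussianVector; infer_instance

/-- The law of a sequence of independent standard Gaussian vectors. -/
noncomputable def gaussianSeq (m : ℕ) : Measure (ℕ → Fin m → ℝ) :=
  Measure.infinitePi fun _ => gaussianVector m

instance (m : ℕ) : IsProbabilityMeasure (gaussianSeq m) := by
  unfold gaussianSeq; infer_instance

theorem map_gaussianSeq (N m : ℕ) :
    (gaussianSeq m).map (fun ω (j : Fin N) => ω j) = gaussianMatrix N m := by
  rw [gaussianSeq, Measure.map_infinitePi_infinitePi_of_inj (f := fun j : Fin N => (j : ℕ))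
    Fin.val_injective, Measure.infinitePi_eq_pi]
  rfl

theorem memLp_eval_gaussianVector {m : ℕ} (a : Fin m) :
    MemLp (fun x : Fin m → ℝ => x a) 2 (gaussianVector m) :=
  (ProbabilityTheory.memLp_id_gaussianReal 2).comp_measurePreserving
    (measurePreserving_eval (fun _ : Fin m => ProbabilityTheory.gaussianReal 0 1) a)

theorem integrable_mul_gaussianVector {m : ℕ} (a b : Fin m) :
    Integrable (fun x : Fin m → ℝ => x a * x b) (gaussianVector m) :=
  (memLp_eval_gaussianVector a).integrable_mul (memLp_eval_gaussianVector b)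

theorem integral_mul_gaussianVector {m : ℕ} (a b : Fin m) :
    ∫ x, x a * x b ∂gaussianVector m = (1 : Matrix (Fin m) (Fin m) ℝ) a b := by
  have hmean : ∀ a : Fin m, ∫ x, x a ∂gaussianVector m = 0 := by
    intro a
    have := integral_comp_eval (μ := fun _ : Fin m => ProbabilityTheory.gaussianReal 0 1) (i := a)
      (f := fun x => x) (by fun_prop)
    rw [gaussianVector, this, ProbabilityTheory.integral_id_gaussianReal]
  by_cases hab : a = b
  · subst hab
    have h1 := integral_comp_eval (μ := fun _ : Fin m => ProbabilityTheory.gaussianReal 0 1)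
      (i := a) (f := fun x => x * x) (by fun_prop)
    have h2 := ProbabilityTheory.variance_eq_sub
      (ProbabilityTheory.memLp_id_gaussianReal (μ := 0) (v := 1) 2)
    rw [ProbabilityTheory.variance_id_gaussianReal] at h2
    simp only [Pi.pow_apply, id, ProbabilityTheory.integral_id_gaussianReal, pow_two] at h2
    rw [gaussianVector, h1, Matrix.one_apply_eq]
    simpa using h2.symm
  · have hind := (ProbabilityTheory.iIndepFun_pi
      (μ := fun _ : Fin m => ProbabilityTheory.gaussianReal 0 1) (X := fun _ x => x)
      (fun _ => by fun_prop)).indepFun hab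
    have := hind.integral_fun_mul_eq_mul_integral
      (measurable_pi_apply a).aestronglyMeasurable (measurable_pi_apply b).aestronglyMeasurable
    rw [Matrix.one_apply_ne hab]
    rw [gaussianVector, this]
    have h0 := hmean a
    rw [gaussianVector] at h0
    rw [h0, zero_mul]

theorem iIndepFun_eval_gaussianSeq (m : ℕ) :
    ProbabilityTheory.iIndepFun (fun n (ω : ℕ → Fin m → ℝ) => ω n) (gaussianSeq m) :=
  ProbabilityTheory.iIndepFun_infinitePi (P := fun _ : ℕ => gaussianVector m)
    (X := fun _ x => x) fun _ => measurable_id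

theorem ae_tendsto_average_gaussianSeq {m : ℕ} (a b : Fin m) :
    ∀ᵐ ω ∂gaussianSeq m, Tendsto (fun N : ℕ => (∑ n ∈ Finset.range N, ω n a * ω n b) / (N : ℝ)) atTop
      (nhds ((1 : Matrix (Fin m) (Fin m) ℝ) a b)) := by
  have hlaw : ∀ n, (gaussianSeq m).map (fun ω => ω n) = gaussianVector m := fun n =>
    Measure.infinitePi_map_eval (fun _ : ℕ => gaussianVector m) n
  have hmp : ∀ n, MeasurePreserving (fun ω : ℕ → Fin m → ℝ => ω n) (gaussianSeq m)
      (gaussianVector m) := fun n => ⟨measurable_pi_apply n, hlaw n⟩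
  have hφ : Measurable fun x : Fin m → ℝ => x a * x b := by fun_prop
  have h_int : Integrable (fun ω : ℕ → Fin m → ℝ => ω 0 a * ω 0 b) (gaussianSeq m) :=
    (hmp 0).integrable_comp_of_integrable (integrable_mul_gaussianVector a b)
  have := ProbabilityTheory.strong_law_ae_real (μ := gaussianSeq m)
    (fun n ω => ω n a * ω n b) h_int
    (fun i j hij => ((iIndepFun_eval_gaussianSeq m).indepFun hij).comp hφ hφ)
    (fun i => ProbabilityTheory.IdentDistrib.comp
      ⟨(measurable_pi_apply i).aemeasurable, (measurable_pi_apply 0).aemeasurable,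
        (hlaw i).trans (hlaw 0).symm⟩ hφ)
  have hE : ∫ ω, ω 0 a * ω 0 b ∂gaussianSeq m = (1 : Matrix (Fin m) (Fin m) ℝ) a b := by
    rw [← integral_mul_gaussianVector, ← hlaw 0, integral_map (measurable_pi_apply 0).aemeasurable
      hφ.aestronglyMeasurable]
  rwa [hE] at this

/-- The event that the contribution of the columns `k ≤ n < N` to the normalized Gram matrix
is entrywise close to the identity. -/
def tailEvent (m k N : ℕ) (η : ℝ) : Set (ℕ → Fin m → ℝ) :=
  {ω | ∀ a b, |(∑ n ∈ Finset.Ico k N, ω n a * ω n b) / N - (1 : Matrix (Fin m) (Fin m) ℝ) a b| < η}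

theorem eventually_half_le_tailEvent (m k : ℕ) {η : ℝ} (hη : 0 < η) :
    ∀ᶠ N in atTop, ENNReal.ofReal (1 / 2) ≤ gaussianSeq m (tailEvent m k N η) := by
  have hmeas : ∀ N, MeasurableSet (tailEvent m k N η) := by
    intro N
    simp only [tailEvent, Set.ofPred_forall]
    refine MeasurableSet.iInter fun a => MeasurableSet.iInter fun b => ?_
    exact measurableSet_lt (by fun_prop) measurable_const
  have hae : ∀ᵐ ω ∂gaussianSeq m, ∀ᶠ N in atTop, ω ∈ tailEvent m k N η ↔ ω ∈ Set.univ := by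
    have hall : ∀ᵐ ω ∂gaussianSeq m, ∀ a b : Fin m,
        Tendsto (fun N : ℕ => (∑ n ∈ Finset.range N, ω n a * ω n b) / (N : ℝ)) atTop
          (nhds ((1 : Matrix (Fin m) (Fin m) ℝ) a b)) :=
      ae_all_iff.2 fun a => ae_all_iff.2 fun b => ae_tendsto_average_gaussianSeq a b
    filter_upwards [hall] with ω hω
    simp only [Set.mem_univ, iff_true, tailEvent, Set.mem_ofPred_eq, eventually_all]
    intro a b
    have h0 : Tendsto (fun N : ℕ => (∑ n ∈ Finset.range k, ω n a * ω n b) / (N : ℝ)) atTop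
        (nhds 0) := tendsto_const_div_atTop_nhds_zero_nat _
    have h1 := (hω a b).sub h0
    rw [sub_zero] at h1
    filter_upwards [h1.eventually (Metric.ball_mem_nhds _ hη), eventually_ge_atTop k] with N hN hk
    rw [Real.dist_eq] at hN
    rwa [Finset.sum_Ico_eq_sub _ hk, sub_div]
  have hlim := tendsto_measure_of_ae_tendsto_indicator_of_isFiniteMeasure (μ := gaussianSeq m)
    atTop MeasurableSet.univ hmeas hae
  rw [measure_univ] at hlim
  have h2 : ENNReal.ofReal (1 / 2) < 1 := by
    rw [ENNReal.ofReal_lt_one]; norm_num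
  exact (hlim.eventually (lt_mem_nhds h2)).mono fun _ h => h.le

theorem ofReal_exp_le_gaussianReal {a c δ : ℝ} (hc : 0 < c)
    (hcδ : c * √(2 * Real.pi) ≤ 2 * δ) :
    ENNReal.ofReal (Real.exp (-((|a| + δ) ^ 2 / (2 * c ^ 2)))) ≤
      ProbabilityTheory.gaussianReal 0 1 {x | |c * x - a| < δ} := by
  have hset : {x | |c * x - a| < δ} = Set.Ioo ((a - δ) / c) ((a + δ) / c) := by
    ext x
    rw [Set.mem_ofPred_eq, abs_lt, Set.mem_Ioo, div_lt_iff₀ hc, lt_div_iff₀ hc]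
    constructor <;> rintro ⟨h1, h2⟩ <;> constructor <;> linarith
  have hmeas : MeasurableSet {x | |c * x - a| < δ} := by rw [hset]; exact measurableSet_Ioo
  have hpi : 0 < √(2 * Real.pi) := Real.sqrt_pos.2 (by positivity)
  set E := Real.exp (-((|a| + δ) ^ 2 / (2 * c ^ 2))) with hE
  have hE0 : 0 < E := Real.exp_pos _
  rw [ProbabilityTheory.gaussianReal_apply 0 one_ne_zero]
  calc ENNReal.ofReal E ≤ ENNReal.ofReal ((√(2 * Real.pi))⁻¹ * E) *
        volume {x | |c * x - a| < δ} := by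
        rw [hset, Real.volume_Ioo, ← ENNReal.ofReal_mul (by positivity)]
        refine ENNReal.ofReal_le_ofReal ?_
        have : (√(2 * Real.pi))⁻¹ * E * ((a + δ) / c - (a - δ) / c) =
            E * (2 * δ / (c * √(2 * Real.pi))) := by
          field_simp; ring
        rw [this]
        exact le_mul_of_one_le_right hE0.le ((one_le_div (by positivity)).2 hcδ)
    _ = ∫⁻ _ in {x | |c * x - a| < δ}, ENNReal.ofReal ((√(2 * Real.pi))⁻¹ * E) := by
        rw [setLIntegral_const]
    _ ≤ _ := by
        refine setLIntegral_mono' hmeas fun x hx => ?_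
        rw [ProbabilityTheory.gaussianPDF_def]
        refine ENNReal.ofReal_le_ofReal ?_
        rw [ProbabilityTheory.gaussianPDFReal]
        simp only [NNReal.coe_one, mul_one, sub_zero]
        refine mul_le_mul_of_nonneg_left (Real.exp_le_exp.2 ?_) (by positivity)
        have h1 : |c * x| ≤ |a| + δ := by
          have := abs_add_le (c * x - a) a
          rw [sub_add_cancel] at this
          have hx' : |c * x - a| < δ := hx
          linarith
        have h2 : (c * x) ^ 2 ≤ (|a| + δ) ^ 2 := sq_le_sq' (by linarith [neg_abs_le (c * x)])
          ((le_abs_self _).trans h1)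
        rw [neg_div, neg_le_neg_iff, div_le_div_iff₀ (by norm_num) (by positivity)]
        nlinarith

/-- The event that the first `k` columns, rescaled by `c`, are entrywise close to those of `A`. -/
def topEvent {m k : ℕ} (A : Matrix (Fin m) (Fin k) ℝ) (c δ : ℝ) : Set (ℕ → Fin m → ℝ) :=
  {ω | ∀ (j : Fin k) a, |c * ω j a - A a j| < δ}

theorem ofReal_exp_le_topEvent {m k : ℕ} (A : Matrix (Fin m) (Fin k) ℝ) {c δ : ℝ} (hc : 0 < c)
    (hcδ : c * √(2 * Real.pi) ≤ 2 * δ) :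
    ENNReal.ofReal (Real.exp (-((∑ a, ∑ j, (|A a j| + δ) ^ 2) / (2 * c ^ 2)))) ≤
      gaussianSeq m (topEvent A c δ) := by
  have hset : topEvent A c δ = (fun ω (j : Fin k) => ω j) ⁻¹'
      Set.pi Set.univ fun j => Set.pi Set.univ fun a => {x : ℝ | |c * x - A a j| < δ} := by
    ext ω
    simp [topEvent, Set.mem_pi]
  have hm1 : ∀ a j, MeasurableSet {x : ℝ | |c * x - A a j| < δ} := fun a j =>
    measurableSet_lt (by fun_prop) measurable_const
  rw [hset, ← Measure.map_apply (by fun_prop) (MeasurableSet.univ_pi fun j =>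
    MeasurableSet.univ_pi fun a => hm1 a j), map_gaussianSeq, gaussianMatrix, Measure.pi_pi]
  simp_rw [Measure.pi_pi]
  calc _ = ∏ j : Fin k, ∏ a : Fin m,
        ENNReal.ofReal (Real.exp (-((|A a j| + δ) ^ 2 / (2 * c ^ 2)))) := by
        simp_rw [← ENNReal.ofReal_prod_of_nonneg fun _ _ => (Real.exp_pos _).le,
          ← Real.exp_sum]
        rw [← ENNReal.ofReal_prod_of_nonneg fun _ _ => (Real.exp_pos _).le, ← Real.exp_sum,
          Finset.sum_comm]
        simp_rw [Finset.sum_neg_distrib, Finset.sum_div]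
    _ ≤ _ := Finset.prod_le_prod' fun j _ => Finset.prod_le_prod' fun a _ =>
        ofReal_exp_le_gaussianReal hc hcδ

theorem gaussianSeq_topEvent_inter_tailEvent {m k : ℕ} (A : Matrix (Fin m) (Fin k) ℝ) (c δ : ℝ)
    (N : ℕ) (η : ℝ) :
    gaussianSeq m (topEvent A c δ ∩ tailEvent m k N η) =
      gaussianSeq m (topEvent A c δ) * gaussianSeq m (tailEvent m k N η) := by
  have hind := (iIndepFun_eval_gaussianSeq m).indepFun_finset (Finset.range k) (Finset.Ico k N)
    (by
      rw [Finset.disjoint_left]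
      intro n h1 h2
      rw [Finset.mem_range] at h1
      rw [Finset.mem_Ico] at h2
      omega) (fun n => measurable_pi_apply n)
  let S : Set (Finset.range k → Fin m → ℝ) :=
    {x | ∀ (j : Fin k) a, |c * x ⟨j, Finset.mem_range.2 j.2⟩ a - A a j| < δ}
  let T : Set (Finset.Ico k N → Fin m → ℝ) :=
    {x | ∀ a b, |(∑ n, x n a * x n b) / N - (1 : Matrix (Fin m) (Fin m) ℝ) a b| < η}
  have hS : MeasurableSet S := by
    simp only [S, Set.ofPred_forall]
    refine MeasurableSet.iInter fun a => MeasurableSet.iInter fun b => ?_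
    exact measurableSet_lt (by fun_prop) measurable_const
  have hT : MeasurableSet T := by
    simp only [T, Set.ofPred_forall]
    refine MeasurableSet.iInter fun a => MeasurableSet.iInter fun b => ?_
    exact measurableSet_lt (by fun_prop) measurable_const
  have h := hind.measure_inter_preimage_eq_mul S T hS hT
  have e1 : (fun (ω : ℕ → Fin m → ℝ) (i : Finset.range k) => ω i) ⁻¹' S = topEvent A c δ := rfl
  have e2 : (fun (ω : ℕ → Fin m → ℝ) (i : Finset.Ico k N) => ω i) ⁻¹' T = tailEvent m k N η := by
    ext ω
    simp only [T, Set.mem_preimage, Set.mem_ofPred_eq, tailEvent]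
    refine forall_congr' fun a => forall_congr' fun b => ?_
    rw [Finset.sum_coe_sort (Finset.Ico k N) fun n => ω n a * ω n b]
  rwa [e1, e2] at h

theorem frobNorm_le_of_forall_abs_le {m k : ℕ} {B : Matrix (Fin m) (Fin k) ℝ} {ε : ℝ}
    (hε : 0 ≤ ε) (hB : ∀ i j, |B i j| ≤ ε) : frobNorm B ≤ m * k * ε := by
  refine Real.sqrt_le_iff.2 ⟨by positivity, ?_⟩
  have h1 : frobSq B ≤ ∑ _i : Fin m, ∑ _j : Fin k, ε ^ 2 :=
    Finset.sum_le_sum fun i _ => Finset.sum_le_sum fun j _ =>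
      sq_le_sq' (neg_le_of_abs_le (hB i j)) (le_of_abs_le (hB i j))
  refine h1.trans ?_
  simp only [Finset.sum_const, Finset.card_univ, Fintype.card_fin, nsmul_eq_mul]
  have h2 : ((m * k : ℕ) : ℝ) ≤ ((m * k : ℕ) : ℝ) ^ 2 := by
    exact_mod_cast Nat.le_self_pow two_ne_zero _
  push_cast at h2
  nlinarith [sq_nonneg ε]

theorem mem_goodSet_of_mem_events {m k N : ℕ} (hk : k ≤ N) {A : Matrix (Fin m) (Fin k) ℝ}
    {c η η' δ δ' R : ℝ} (hc : 0 < c) (hR : ∀ a j, |A a j| ≤ R) (hη' : 0 ≤ η') (hδ' : 0 ≤ δ')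
    (hsmall : k * ((R + δ') / c) ^ 2 / N ≤ η') (hη : m * m * (2 * η') < η)
    (hδ : m * k * δ' < δ) {ω : ℕ → Fin m → ℝ} (htop : ω ∈ topEvent A c δ')
    (htail : ω ∈ tailEvent m k N η') : (fun j : Fin N => ω j) ∈ goodSet hk A c η δ := by
  constructor
  · refine (frobNorm_le_of_forall_abs_le (ε := 2 * η') (by positivity) fun a b => ?_).trans_lt hη
    have hω : ∀ j ∈ Finset.range k, ∀ a, |ω j a| ≤ (R + δ') / c := by
      intro j hj a
      rw [le_div_iff₀' hc]
      nth_rw 1 [← abs_of_pos hc]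
      rw [← abs_mul]
      have h1 := htop ⟨j, Finset.mem_range.1 hj⟩ a
      have h2 := abs_add_le (c * ω j a - A a ⟨j, Finset.mem_range.1 hj⟩)
        (A a ⟨j, Finset.mem_range.1 hj⟩)
      rw [sub_add_cancel] at h2
      have h3 := hR a ⟨j, Finset.mem_range.1 hj⟩
      linarith
    have hhead : |(∑ n ∈ Finset.range k, ω n a * ω n b) / N| ≤ η' := by
      refine le_trans ?_ hsmall
      rw [abs_div, Nat.abs_cast]
      refine div_le_div_of_nonneg_right ?_ (Nat.cast_nonneg _)
      refine (Finset.abs_sum_le_sum_abs _ _).trans ?_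
      refine (Finset.sum_le_card_nsmul _ _ (((R + δ') / c) ^ 2) fun j hj => ?_).trans_eq (by simp)
      rw [abs_mul, pow_two]
      exact mul_le_mul (hω j hj a) (hω j hj b) (abs_nonneg _) ((abs_nonneg _).trans (hω j hj a))
    have hgram : ((N : ℝ)⁻¹ • gramMatrix (fun j : Fin N => ω j) - 1) a b =
        (∑ n ∈ Finset.range k, ω n a * ω n b) / N + ((∑ n ∈ Finset.Ico k N, ω n a * ω n b) / N -
          (1 : Matrix (Fin m) (Fin m) ℝ) a b) := by
      rw [← add_sub_assoc, ← add_div, Finset.sum_range_add_sum_Ico _ hk,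
        ← Fin.sum_univ_eq_sum_range fun n => ω n a * ω n b]
      simp only [gramMatrix, Matrix.sub_apply, Matrix.smul_apply, Matrix.mul_apply,
        Matrix.transpose_apply, Matrix.of_apply, smul_eq_mul]
      ring
    rw [hgram]
    refine (abs_add_le _ _).trans ?_
    have := htail a b
    linarith
  · refine (frobNorm_le_of_forall_abs_le hδ' fun a j => ?_).trans_lt hδ
    exact (htop j a).le

theorem eventually_le_gaussianMatrix_goodSet {m k : ℕ} {β : ℕ → ℝ} (hβ_pos : ∀ N, 0 < β N)
    (hβ_top : Tendsto β atTop atTop) (hβ_o : β =o[atTop] fun N => Real.sqrt N)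
    (A : Matrix (Fin m) (Fin k) ℝ) {η δ δ' : ℝ} (hη : 0 < η) (hδ' : 0 < δ')
    (hδ : m * k * δ' < δ) :
    ∀ᶠ N : ℕ in atTop, ∀ hk : k ≤ N,
      ENNReal.ofReal (1 / 2 *
        Real.exp (-((∑ a, ∑ j, (|A a j| + δ') ^ 2) / (2 * (β N / √N) ^ 2)))) ≤
      gaussianMatrix N m (goodSet hk A (β N / √N) η δ) := by
  obtain ⟨R, hR⟩ : ∃ R, ∀ a j, |A a j| ≤ R :=
    ⟨frobNorm A, fun a j => Real.abs_le_sqrt <|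
      (Finset.single_le_sum (f := fun j => A a j ^ 2) (fun _ _ => sq_nonneg _)
        (Finset.mem_univ j)).trans <|
      Finset.single_le_sum (f := fun a => ∑ j, A a j ^ 2)
        (fun _ _ => Finset.sum_nonneg fun _ _ => sq_nonneg _) (Finset.mem_univ a)⟩
  set η' : ℝ := η / (2 * (m * m + 1)) with hη'def
  have hη' : 0 < η' := by positivity
  have hηη' : m * m * (2 * η') < η := by
    have : η' * (2 * (m * m + 1)) = η := by rw [hη'def]; field_simp
    nlinarith
  have hc : Tendsto (fun N : ℕ => β N / √N) atTop (nhds 0) := hβ_o.tendsto_div_nhds_zero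
  have hc2 : Tendsto (fun N : ℕ => β N / √N * √(2 * Real.pi)) atTop (nhds 0) := by
    simpa using hc.mul_const (√(2 * Real.pi))
  have hsm : Tendsto (fun N : ℕ => k * (R + δ') ^ 2 / β N ^ 2) atTop (nhds 0) :=
    ((tendsto_pow_atTop two_ne_zero).comp hβ_top).const_div_atTop _
  filter_upwards [hc2.eventually (gt_mem_nhds (by positivity : 0 < 2 * δ')),
    hsm.eventually (gt_mem_nhds hη'), eventually_gt_atTop 0,
    eventually_half_le_tailEvent m k hη'] with N hN1 hN2 hN0 hN3 hk
  have hNs : (0 : ℝ) < √N := Real.sqrt_pos.2 (by exact_mod_cast hN0)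
  have hβN := hβ_pos N
  have hc0 : 0 < β N / √N := div_pos hβN hNs
  have hsmall : k * ((R + δ') / (β N / √N)) ^ 2 / N ≤ η' := by
    refine le_trans (le_of_eq ?_) hN2.le
    have hsq : (√N : ℝ) ^ 2 = N := Real.sq_sqrt (Nat.cast_nonneg _)
    have hNne : (N : ℝ) ≠ 0 := by positivity
    rw [div_div_eq_mul_div, div_pow, mul_pow, hsq]
    field_simp
  rw [mul_comm, ENNReal.ofReal_mul (Real.exp_pos _).le]
  calc _ ≤ gaussianSeq m (topEvent A (β N / √N) δ') * gaussianSeq m (tailEvent m k N η') :=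
        mul_le_mul' (ofReal_exp_le_topEvent A hc0 hN1.le) hN3
    _ = gaussianSeq m (topEvent A (β N / √N) δ' ∩ tailEvent m k N η') :=
        (gaussianSeq_topEvent_inter_tailEvent _ _ _ _ _).symm
    _ ≤ gaussianSeq m ((fun ω (j : Fin N) => ω j) ⁻¹' goodSet hk A (β N / √N) η δ) :=
        measure_mono fun ω hω =>
          mem_goodSet_of_mem_events hk hc0 hR hη'.le hδ'.le hsmall hηη' hδ hω.1 hω.2
    _ = _ := by
        rw [← map_gaussianSeq, Measure.map_apply (by fun_prop) (measurableSet_goodSet _ _ _ _ _)]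

/-- **Weak MDP lower bound for the `m × k` block of a Haar orthogonal matrix**: for every
`A ∈ ℝ^{m×k}`, `lim_{r→0} liminf_N (β_N²/N)·log ℙ(β_N Z_N ∈ B_r(A)) ≥ -(1/2)‖A‖_F²`
(the limit as `r → 0` is, by monotonicity, the infimum over `r > 0`). Here `μ N` is the
Haar probability measure on `O(N)`, viewed as a measure on `N × N` matrices. -/
theorem stmt_11
    (m k : ℕ)
    (μ : (N : ℕ) → Measure (Matrix (Fin N) (Fin N) ℝ))
    (hμ_prob : ∀ N, IsProbabilityMeasure (μ N))
    (hμ_supp : ∀ N, μ N {A | A * Aᵀ = 1} = 1)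
    (hμ_inv : ∀ N (B : Matrix (Fin N) (Fin N) ℝ), B * Bᵀ = 1 →
      (μ N).map (fun A => B * A) = μ N)
    (β : ℕ → ℝ) (hβ_pos : ∀ N, 0 < β N)
    (hβ_top : Tendsto β atTop atTop)
    (hβ_o : β =o[atTop] fun N => Real.sqrt N)
    (A : Matrix (Fin m) (Fin k) ℝ) :
    ((-(1 / 2) * frobSq A : ℝ) : EReal) ≤
      ⨅ r ∈ Set.Ioi (0 : ℝ),
        Filter.liminf (fun N => ((β N ^ 2 / N : ℝ) : EReal) *
          ENNReal.log (μ N {M | frobNorm (β N • blockEmb m k M - A) < r})) atTop := by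
  refine le_iInf₂ fun r hr => ?_
  have hr : 0 < r := hr
  rw [le_liminf_iff']
  intro y hy
  obtain ⟨z, hyz, hz⟩ := EReal.lt_iff_exists_real_btwn.1 hy
  have hz : z < -(1 / 2) * frobSq A := by exact_mod_cast hz
  obtain ⟨η, hη, hη2, hηr⟩ : ∃ η > 0, η ≤ 1 / 2 ∧ η * (r / 2) + r / 2 + η * frobNorm A ≤ r := by
    have hA := frobNorm_nonneg A
    refine ⟨min (1 / 2) (r / 2 / (r / 2 + frobNorm A)), by positivity, min_le_left _ _, ?_⟩
    have h := min_le_right (1 / 2) (r / 2 / (r / 2 + frobNorm A))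
    rw [le_div_iff₀ (by positivity)] at h
    linarith
  obtain ⟨δ, hδ, hδr, hδz⟩ : ∃ δ > 0, m * k * δ < r / 2 ∧
      z < -(1 / 2) * ∑ a, ∑ j, (|A a j| + δ) ^ 2 := by
    have h1 : Tendsto (fun δ : ℝ => m * k * δ) (nhdsWithin 0 (Set.Ioi 0)) (nhds 0) := by
      have : Continuous fun δ : ℝ => m * k * δ := by fun_prop
      simpa using (this.tendsto 0).mono_left nhdsWithin_le_nhds
    have h2 : Tendsto (fun δ : ℝ => -(1 / 2) * ∑ a, ∑ j, (|A a j| + δ) ^ 2)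
        (nhdsWithin 0 (Set.Ioi 0)) (nhds (-(1 / 2) * frobSq A)) := by
      have : Continuous fun δ : ℝ => -(1 / 2) * ∑ a, ∑ j, (|A a j| + δ) ^ 2 := by fun_prop
      have := (this.tendsto 0).mono_left (nhdsWithin_le_nhds (s := Set.Ioi 0))
      simpa [frobSq] using this
    obtain ⟨δ, hδ, h3, h4⟩ := (eventually_mem_nhdsWithin.and
      ((h1.eventually (gt_mem_nhds (half_pos hr))).and (h2.eventually (lt_mem_nhds hz)))).exists
    exact ⟨δ, hδ, h3, h4⟩
  set K := ∑ a, ∑ j, (|A a j| + δ) ^ 2 with hK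
  have hc : Tendsto (fun N : ℕ => β N / √N) atTop (nhds 0) := hβ_o.tendsto_div_nhds_zero
  have hlim : Tendsto (fun N : ℕ => (β N / √N) ^ 2 * Real.log (1 / 2) - 1 / 2 * K) atTop
      (nhds (-(1 / 2) * K)) := by
    have := ((hc.pow 2).mul_const (Real.log (1 / 2))).sub_const (1 / 2 * K)
    simpa using this
  filter_upwards [hlim.eventually (lt_mem_nhds hδz), eventually_ge_atTop (m + k + 1),
    eventually_le_gaussianMatrix_goodSet hβ_pos hβ_top hβ_o A hη hδ hδr] with N hNz hN hG
  have := hμ_prob N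
  have hae : ∀ᵐ M ∂μ N, M * Mᵀ = 1 :=
    (mem_ae_iff_prob_eq_one (measurableSet_orthogonal N)).2 (hμ_supp N)
  have hN0 : (0 : ℝ) < √N := Real.sqrt_pos.2 (by exact_mod_cast (by omega : 0 < N))
  have hc0 : 0 < β N / √N := div_pos (hβ_pos N) hN0
  have hcc : (β N / √N) ^ 2 = β N ^ 2 / N := by
    rw [div_pow, Real.sq_sqrt (Nat.cast_nonneg _)]
  have hle := (hG (by omega)).trans
    (gaussianMatrix_goodSet_le (by omega) (by omega) (μ N) hae (hμ_inv N) A hη2 hηr)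
  have hpos : 0 < 1 / 2 * Real.exp (-(K / (2 * (β N / √N) ^ 2))) := by positivity
  have hlog := ENNReal.log_le_log hle
  rw [ENNReal.log_ofReal_of_pos hpos, Real.log_mul (by norm_num) (Real.exp_ne_zero _),
    Real.log_exp] at hlog
  rw [← hcc]
  calc y ≤ (z : EReal) := hyz.le
    _ ≤ (((β N / √N) ^ 2 * (Real.log (1 / 2) + -(K / (2 * (β N / √N) ^ 2))) : ℝ) : EReal) := by
        refine EReal.coe_le_coe_iff.2 ?_
        have : (β N / √N) ^ 2 * (Real.log (1 / 2) + -(K / (2 * (β N / √N) ^ 2))) =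
            (β N / √N) ^ 2 * Real.log (1 / 2) - 1 / 2 * K := by
          generalize β N / √N = c at hc0
          field_simp
          ring
        rw [this]
        exact hNz.le
    _ ≤ _ := by
        rw [EReal.coe_mul]
        exact mul_le_mul_of_nonneg_left hlog (EReal.coe_nonneg.2 (sq_nonneg _))
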